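/- Let u ∈ C³(Q̄_T) be an admissible solution of equation (E) and let φ ∈ C³(Q̄_T). Then for every K > 0 there exists a constant C > 0, depending only on n, Ω, T, A, ψ and K, such that whenever |u|_{C¹_x(Q̄_T)} ≤ K and |φ|_{C³(Q̄_T)} ≤ K, for every k ∈ {1,…,n} one has at each point of Q_T the inequality 𝓛(∂_k(u − φ)) ≤ C (1 + Σ_i f_i(λ)|λ_i| + Σ_i f_i(λ)), where λ = λ(U[u]) and f_i = ∂f/∂λ_i evaluated at λ. -/

import Mathlib

open scoped BigOperators Topology

noncomputable section

namespace ParabolicHessian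

/-- Square real matrices of size `n`. -/
abbrev Mat (n : ℕ) := Matrix (Fin n) (Fin n) ℝ

/-- Eigenvalue vector of a real matrix (junk value `0` if not symmetric). -/
def eigenVec {n : ℕ} (S : Mat n) : Fin n → ℝ :=
  if h : S.IsHermitian then h.eigenvalues else 0

/-- Spatial gradient of `v : ℝⁿ → ℝ`. -/
def sgrad {n : ℕ} (v : (Fin n → ℝ) → ℝ) (x : Fin n → ℝ) : Fin n → ℝ :=
  fun i => fderiv ℝ v x (Pi.single i 1)

/-- Spatial Hessian of `v : ℝⁿ → ℝ`, as a matrix. -/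
def shess {n : ℕ} (v : (Fin n → ℝ) → ℝ) (x : Fin n → ℝ) : Mat n :=
  Matrix.of fun i j => fderiv ℝ (fun y => fderiv ℝ v y (Pi.single j 1)) x (Pi.single i 1)

/-- Quadratic form `ξᵀ S ξ`. -/
def qform {n : ℕ} (S : Mat n) (ξ : Fin n → ℝ) : ℝ :=
  ∑ i, ∑ j, ξ i * S i j * ξ j

/-- Norm of a matrix (sup norm on `Fin n → Fin n → ℝ`). -/
def matNorm {n : ℕ} (S : Mat n) : ℝ := ‖(fun i j => S i j : Fin n → Fin n → ℝ)‖

/-- The parabolic cylinder `Q_T = Ω × (0,T]`. -/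
def QT {n : ℕ} (Ω : Set (Fin n → ℝ)) (T : ℝ) : Set ((Fin n → ℝ) × ℝ) :=
  Ω ×ˢ Set.Ioc 0 T

/-- `Q̄_T = Ω̄ × [0,T]`. -/
def QTbar {n : ℕ} (Ω : Set (Fin n → ℝ)) (T : ℝ) : Set ((Fin n → ℝ) × ℝ) :=
  closure Ω ×ˢ Set.Icc 0 T

/-- The parabolic boundary `𝒫Q_T = (Ω̄ × {0}) ∪ (∂Ω × [0,T])`. -/
def PQ {n : ℕ} (Ω : Set (Fin n → ℝ)) (T : ℝ) : Set ((Fin n → ℝ) × ℝ) :=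
  (closure Ω ×ˢ ({0} : Set ℝ)) ∪ (frontier Ω ×ˢ Set.Icc 0 T)

/-- `Ω` has smooth boundary (encoded via a smooth defining function). -/
def SmoothBoundary {n : ℕ} (Ω : Set (Fin n → ℝ)) : Prop :=
  ∃ ρ : (Fin n → ℝ) → ℝ, ContDiff ℝ (⊤ : ℕ∞) ρ ∧ Ω = {x | ρ x < 0} ∧
    ∀ x ∈ frontier Ω, fderiv ℝ ρ x ≠ 0

/-- `Γ` is an open convex symmetric proper cone with vertex `0`
containing the positive cone. -/
def GoodCone {n : ℕ} (Γ : Set (Fin n → ℝ)) : Prop :=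
  IsOpen Γ ∧ Convex ℝ Γ ∧ (∀ lam ∈ Γ, ∀ s : ℝ, 0 < s → s • lam ∈ Γ) ∧
    (∀ σ : Equiv.Perm (Fin n), ∀ lam ∈ Γ, lam ∘ σ ∈ Γ) ∧
    {lam : Fin n → ℝ | ∀ i, 0 < lam i} ⊆ Γ ∧ Γ ≠ Set.univ

/-- `f` is smooth and symmetric on `Γ`. -/
def SmoothSymF {n : ℕ} (Γ : Set (Fin n → ℝ)) (f : (Fin n → ℝ) → ℝ) : Prop :=
  ContDiffOn ℝ (⊤ : ℕ∞) f Γ ∧ ∀ σ : Equiv.Perm (Fin n), ∀ lam ∈ Γ, f (lam ∘ σ) = f lam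

/-- `f_i = ∂f/∂λ_i`. -/
def fLam {n : ℕ} (f : (Fin n → ℝ) → ℝ) (lam : Fin n → ℝ) (i : Fin n) : ℝ :=
  fderiv ℝ f lam (Pi.single i 1)

/-- (f1): `∂f/∂λ_i > 0` on `Γ`. -/
def F1cond {n : ℕ} (Γ : Set (Fin n → ℝ)) (f : (Fin n → ℝ) → ℝ) : Prop :=
  ∀ lam ∈ Γ, ∀ i, 0 < fLam f lam i

/-- (f2): `f` is concave on `Γ`. -/
def F2cond {n : ℕ} (Γ : Set (Fin n → ℝ)) (f : (Fin n → ℝ) → ℝ) : Prop :=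
  ConcaveOn ℝ Γ f

/-- (f5): `f > 0` on `Γ` and `f → 0` at every boundary point of `Γ`. -/
def F5cond {n : ℕ} (Γ : Set (Fin n → ℝ)) (f : (Fin n → ℝ) → ℝ) : Prop :=
  (∀ lam ∈ Γ, 0 < f lam) ∧
    ∀ lam₀ ∈ frontier Γ, Filter.Tendsto f (nhdsWithin lam₀ Γ) (nhds 0)

/-- `A(x,t,p)` is a smooth symmetric-matrix-valued function. -/
def ASmooth {n : ℕ} (A : (Fin n → ℝ) → ℝ → (Fin n → ℝ) → Mat n) : Prop :=
  (∀ x t p, (A x t p).IsSymm) ∧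
    ∀ i j, ContDiff ℝ (⊤ : ℕ∞)
      (fun q : ((Fin n → ℝ) × ℝ) × (Fin n → ℝ) => A q.1.1 q.1.2 q.2 i j)

/-- `ψ(x,t,z,p)` is smooth. -/
def PsiSmooth {n : ℕ} (ψ : (Fin n → ℝ) → ℝ → ℝ → (Fin n → ℝ) → ℝ) : Prop :=
  ContDiff ℝ (⊤ : ℕ∞)
    (fun q : ((Fin n → ℝ) × ℝ) × ℝ × (Fin n → ℝ) => ψ q.1.1 q.1.2 q.2.1 q.2.2)

/-- `u ∈ C^k`, jointly in `(x,t)`. -/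
def RegN {n : ℕ} (k : ℕ) (u : (Fin n → ℝ) → ℝ → ℝ) : Prop :=
  ContDiff ℝ (k : ℕ∞) fun q : (Fin n → ℝ) × ℝ => u q.1 q.2

/-- `u ∈ C^∞`, jointly in `(x,t)`. -/
def RegInf {n : ℕ} (u : (Fin n → ℝ) → ℝ → ℝ) : Prop :=
  ContDiff ℝ (⊤ : ℕ∞) fun q : (Fin n → ℝ) × ℝ => u q.1 q.2

/-- `U[u] = D²u + A(x,t,Du)`. -/
def Umat {n : ℕ} (A : (Fin n → ℝ) → ℝ → (Fin n → ℝ) → Mat n)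
    (u : (Fin n → ℝ) → ℝ → ℝ) (x : Fin n → ℝ) (t : ℝ) : Mat n :=
  shess (fun y => u y t) x + A x t (sgrad (fun y => u y t) x)

/-- `u` is admissible on `Q`: `λ(U[u]) ∈ Γ` on `Q`. -/
def Admissible {n : ℕ} (Γ : Set (Fin n → ℝ))
    (A : (Fin n → ℝ) → ℝ → (Fin n → ℝ) → Mat n)
    (u : (Fin n → ℝ) → ℝ → ℝ) (Q : Set ((Fin n → ℝ) × ℝ)) : Prop :=
  ∀ q ∈ Q, eigenVec (Umat A u q.1 q.2) ∈ Γ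

/-- Equation (E): `f(λ(D²u + A(x,t,Du))) − ∂ₜu = ψ(x,t,u,Du)` on `Q`. -/
def SolvesE {n : ℕ} (f : (Fin n → ℝ) → ℝ)
    (A : (Fin n → ℝ) → ℝ → (Fin n → ℝ) → Mat n)
    (ψ : (Fin n → ℝ) → ℝ → ℝ → (Fin n → ℝ) → ℝ)
    (u : (Fin n → ℝ) → ℝ → ℝ) (Q : Set ((Fin n → ℝ) × ℝ)) : Prop :=
  ∀ q ∈ Q, f (eigenVec (Umat A u q.1 q.2)) - deriv (u q.1) q.2
    = ψ q.1 q.2 (u q.1 q.2) (sgrad (fun y => u y q.2) q.1)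

/-- (A2): `−ψ` and `ξᵀAξ` are concave in `p`. -/
def A2cond {n : ℕ} (A : (Fin n → ℝ) → ℝ → (Fin n → ℝ) → Mat n)
    (ψ : (Fin n → ℝ) → ℝ → ℝ → (Fin n → ℝ) → ℝ) : Prop :=
  (∀ x t z, ConcaveOn ℝ Set.univ fun p : Fin n → ℝ => -(ψ x t z p)) ∧
    ∀ x t (ξ : Fin n → ℝ), ConcaveOn ℝ Set.univ fun p => qform (A x t p) ξ

/-- (A4): `ψ_z ≤ 0`. -/
def A4cond {n : ℕ} (ψ : (Fin n → ℝ) → ℝ → ℝ → (Fin n → ℝ) → ℝ) : Prop :=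
  ∀ x t z p, deriv (fun w => ψ x t w p) z ≤ 0

/-- (sub): `u̲` is an admissible strict subsolution with gap `δ₀` on `Q`. -/
def Subsol {n : ℕ} (Γ : Set (Fin n → ℝ)) (f : (Fin n → ℝ) → ℝ)
    (A : (Fin n → ℝ) → ℝ → (Fin n → ℝ) → Mat n)
    (ψ : (Fin n → ℝ) → ℝ → ℝ → (Fin n → ℝ) → ℝ) (δ₀ : ℝ)
    (ub : (Fin n → ℝ) → ℝ → ℝ) (Q : Set ((Fin n → ℝ) × ℝ)) : Prop :=
  Admissible Γ A ub Q ∧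
    ∀ q ∈ Q, f (eigenVec (Umat A ub q.1 q.2)) - deriv (ub q.1) q.2
      ≥ ψ q.1 q.2 (ub q.1 q.2) (sgrad (fun y => ub y q.2) q.1) + δ₀

/-- `F(h) := f(λ(h))` (extended to all of matrix space by symmetrizing `h`). -/
def Ffunc {n : ℕ} (f : (Fin n → ℝ) → ℝ) (h : Fin n → Fin n → ℝ) : ℝ :=
  f (eigenVec (Matrix.of fun i j => (h i j + h j i) / 2))

/-- `F^{ij} = ∂F/∂h_{ij}`, evaluated at the matrix `U`. -/
def Fmat {n : ℕ} (f : (Fin n → ℝ) → ℝ) (U : Mat n) : Mat n :=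
  Matrix.of fun i j =>
    fderiv ℝ (Ffunc f) (fun a b => U a b) (Pi.single i (Pi.single j 1))

/-- The linearized operator
`𝓛v = Σ F^{ij} ∂²v/∂x_i∂x_j + Σ_k (Σ F^{ij} ∂A^{ij}/∂p_k − ψ_{p_k}) ∂v/∂x_k − ∂ₜv`,
where the coefficients are evaluated at `u`. -/
def Lop {n : ℕ} (f : (Fin n → ℝ) → ℝ)
    (A : (Fin n → ℝ) → ℝ → (Fin n → ℝ) → Mat n)
    (ψ : (Fin n → ℝ) → ℝ → ℝ → (Fin n → ℝ) → ℝ)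
    (u v : (Fin n → ℝ) → ℝ → ℝ) (x : Fin n → ℝ) (t : ℝ) : ℝ :=
  (∑ i, ∑ j, Fmat f (Umat A u x t) i j * shess (fun y => v y t) x i j)
    + (∑ k, ((∑ i, ∑ j, Fmat f (Umat A u x t) i j *
          fderiv ℝ (fun p => A x t p i j) (sgrad (fun y => u y t) x) (Pi.single k 1))
        - fderiv ℝ (fun p => ψ x t (u x t) p) (sgrad (fun y => u y t) x) (Pi.single k 1))
        * sgrad (fun y => v y t) x k)
    - deriv (v x) t

/-- Pointwise bound for the `C¹_x` norm `|u| + |Du|` on `Q`. -/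
def C1xBound {n : ℕ} (u : (Fin n → ℝ) → ℝ → ℝ) (Q : Set ((Fin n → ℝ) × ℝ)) (K : ℝ) : Prop :=
  ∀ q ∈ Q, |u q.1 q.2| + ‖sgrad (fun y => u y q.2) q.1‖ ≤ K

/-- Pointwise bound for the `C²` norm `|v| + |Dv| + |D²v| + |∂ₜv|` on `Q`. -/
def C2Bound {n : ℕ} (v : (Fin n → ℝ) → ℝ → ℝ) (Q : Set ((Fin n → ℝ) × ℝ)) (K : ℝ) : Prop :=
  ∀ q ∈ Q, |v q.1 q.2| + ‖sgrad (fun y => v y q.2) q.1‖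
    + matNorm (shess (fun y => v y q.2) q.1) + |deriv (v q.1) q.2| ≤ K

/-- Bound `K` for all derivatives of `φ` of order ≤ `k₀` on `Q`. -/
def CkBound {n : ℕ} (k₀ : ℕ) (φ : (Fin n → ℝ) → ℝ → ℝ)
    (Q : Set ((Fin n → ℝ) × ℝ)) (K : ℝ) : Prop :=
  ∀ q ∈ Q, ∀ k : ℕ, k ≤ k₀ →
    ‖iteratedFDeriv ℝ k (fun p : (Fin n → ℝ) × ℝ => φ p.1 p.2) q‖ ≤ K

/-- First half of (A1): `p·∇_x(ξᵀAξ) ≤ ψ̄₁(x,t)|ξ|²(1+|p|^{γ₁})`. -/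
def A1a {n : ℕ} (A : (Fin n → ℝ) → ℝ → (Fin n → ℝ) → Mat n)
    (ψb1 : (Fin n → ℝ) → ℝ → ℝ) (γ₁ : ℝ) (Ω : Set (Fin n → ℝ)) (T : ℝ) : Prop :=
  ∀ x ∈ closure Ω, ∀ t ∈ Set.Icc (0 : ℝ) T, ∀ p ξ : Fin n → ℝ,
    fderiv ℝ (fun y => qform (A y t p) ξ) x p ≤ ψb1 x t * ‖ξ‖ ^ 2 * (1 + ‖p‖ ^ γ₁)

/-- Second half of (A1): `p·∇_xψ + |p|²ψ_z ≥ −ψ̄₂(x,t,z)(1+|p|^{γ₂})`. -/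
def A1b {n : ℕ} (ψ : (Fin n → ℝ) → ℝ → ℝ → (Fin n → ℝ) → ℝ)
    (ψb2 : (Fin n → ℝ) → ℝ → ℝ → ℝ) (γ₂ : ℝ) (Ω : Set (Fin n → ℝ)) (T : ℝ) : Prop :=
  ∀ x ∈ closure Ω, ∀ t ∈ Set.Icc (0 : ℝ) T, ∀ z : ℝ, ∀ p : Fin n → ℝ,
    fderiv ℝ (fun y => ψ y t z p) x p + ‖p‖ ^ 2 * deriv (fun w => ψ x t w p) z
      ≥ -(ψb2 x t z * (1 + ‖p‖ ^ γ₂))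

/-- (A3): strict concavity of `p ↦ ξᵀA(x,t,p)ξ`. -/
def A3cond {n : ℕ} (A : (Fin n → ℝ) → ℝ → (Fin n → ℝ) → Mat n) (c₀ : ℝ) : Prop :=
  ∀ x t (p ξ η : Fin n → ℝ),
    fderiv ℝ (fun q => fderiv ℝ (fun r => qform (A x t r) ξ) q η) p η
      ≤ -c₀ * ‖ξ‖ ^ 2 * ‖η‖ ^ 2 + c₀ * (∑ i, ξ i * η i) ^ 2


open Matrix in
/-- `S = W diag(μ) Wᵀ` with `W` orthogonal. -/
def IsOrthDiag {n : ℕ} (S W : Mat n) (μ : Fin n → ℝ) : Prop :=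
  Wᵀ * W = 1 ∧ S = W * diagonal μ * Wᵀ

/-- The matrix `W diag(∇f(μ)) Wᵀ`. -/
def specGrad {n : ℕ} (f : (Fin n → ℝ) → ℝ) (W : Mat n) (μ : Fin n → ℝ) : Mat n :=
  W * Matrix.diagonal (fLam f μ) * W.transpose

lemma conj_diagonal_apply {n : ℕ} (W : Mat n) (d : Fin n → ℝ) (i j : Fin n) :
    (W * Matrix.diagonal d * W.transpose) i j = ∑ l, d l * (W i l * W j l) := by
  rw [Matrix.mul_apply]
  refine Finset.sum_congr rfl fun l _ => ?_
  rw [Matrix.mul_diagonal, Matrix.transpose_apply]; ring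

lemma transpose_mul_mul_apply_self {n : ℕ} (S V : Mat n) (i : Fin n) :
    (V.transpose * S * V) i i = ∑ a, ∑ b, V a i * V b i * S a b := by
  rw [Matrix.mul_apply, Finset.sum_comm]
  refine Finset.sum_congr rfl fun b _ => ?_
  rw [Matrix.mul_apply, Finset.sum_mul]
  refine Finset.sum_congr rfl fun a _ => ?_
  rw [Matrix.transpose_apply]; ring

lemma isOrthDiag_eigenVec {n : ℕ} {S : Mat n} (hS : S.IsHermitian) :
    ∃ W, IsOrthDiag S W (eigenVec S) := by
  refine ⟨hS.eigenvectorUnitary, ?_, ?_⟩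
  · have := (Matrix.mem_unitaryGroup_iff').1 hS.eigenvectorUnitary.2
    simpa [Matrix.star_eq_conjTranspose, Matrix.conjTranspose_eq_transpose_of_trivial] using this
  · have := hS.spectral_theorem
    rw [Unitary.conjStarAlgAut_apply] at this
    simp only [eigenVec, hS, dif_pos]
    conv_lhs => rw [this]
    simp [Matrix.star_eq_conjTranspose, Matrix.conjTranspose_eq_transpose_of_trivial]

lemma exists_perm_of_map_univ_eq {ι α : Type*} [Fintype ι] [DecidableEq α] {f g : ι → α}
    (h : Multiset.map f Finset.univ.val = Multiset.map g Finset.univ.val) :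
    ∃ σ : Equiv.Perm ι, f = g ∘ σ := by
  classical
  have e : ∀ c, Nonempty ({a // f a = c} ≃ {b // g b = c}) := by
    intro c
    refine ⟨Fintype.equivOfCardEq ?_⟩
    have h1 := congrArg (Multiset.count c) h
    rw [Multiset.count_map, Multiset.count_map] at h1
    rw [Fintype.card_subtype, Fintype.card_subtype, Finset.card_def, Finset.card_def]
    simpa [eq_comm] using h1
  refine ⟨Equiv.ofFiberEquiv fun c => (e c).some, ?_⟩
  funext i
  exact (Equiv.ofFiberEquiv_map _ i).symm

lemma IsOrthDiag.isHermitian {n : ℕ} {S W : Mat n} {μ : Fin n → ℝ} (h : IsOrthDiag S W μ) :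
    S.IsHermitian := by
  ext i j
  rw [h.2, Matrix.conjTranspose_apply, conj_diagonal_apply, conj_diagonal_apply]
  simp [mul_comm]

lemma IsOrthDiag.exists_perm {n : ℕ} {S W : Mat n} {μ : Fin n → ℝ} (h : IsOrthDiag S W μ) :
    ∃ σ : Equiv.Perm (Fin n), eigenVec S = μ ∘ σ := by
  have hS := h.isHermitian
  apply exists_perm_of_map_univ_eq
  have h1 := hS.roots_charpoly_eq_eigenvalues
  have h2 : S.charpoly = (Matrix.diagonal μ).charpoly := by
    rw [h.2, Matrix.charpoly_mul_comm, ← mul_assoc, h.1, one_mul]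
  rw [h2, Matrix.charpoly_diagonal, Polynomial.roots_prod _ _
    (by simp [Finset.prod_ne_zero_iff, Polynomial.X_sub_C_ne_zero])] at h1
  simp only [eigenVec, hS, dif_pos]
  simpa [Multiset.bind_singleton] using h1.symm

lemma IsOrthDiag.diagonal_eq {n : ℕ} {S W : Mat n} {μ : Fin n → ℝ} (h : IsOrthDiag S W μ)
    (i : Fin n) : ∑ a, ∑ b, W a i * W b i * S a b = μ i := by
  have h1 : W.transpose * S * W = Matrix.diagonal μ := by
    rw [h.2]
    calc _ = (W.transpose * W) * Matrix.diagonal μ * (W.transpose * W) := by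
          simp only [mul_assoc]
      _ = _ := by rw [h.1]; simp
  rw [← transpose_mul_mul_apply_self, h1, Matrix.diagonal_apply_eq]

lemma abs_le_one_of_orth {n : ℕ} {W : Mat n} (h : W.transpose * W = 1) (i j : Fin n) :
    |W i j| ≤ 1 := by
  have h2 := congrFun (congrFun h j) j
  rw [Matrix.one_apply_eq, Matrix.mul_apply] at h2
  simp only [Matrix.transpose_apply] at h2
  have := Finset.single_le_sum (f := fun l => W l j * W l j)
    (fun l _ => mul_self_nonneg _) (Finset.mem_univ i)
  rw [h2] at this
  exact abs_le_one_iff_mul_self_le_one.2 this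

lemma mulVec_mem_and_le_of_doublyStochastic {n : ℕ} {Γ : Set (Fin n → ℝ)}
    {f : (Fin n → ℝ) → ℝ} (hΓ : ∀ σ : Equiv.Perm (Fin n), ∀ lam ∈ Γ, lam ∘ σ ∈ Γ)
    (hf : ∀ σ : Equiv.Perm (Fin n), ∀ lam ∈ Γ, f (lam ∘ σ) = f lam) (hc : ConcaveOn ℝ Γ f)
    {M : Mat n} (hM : M ∈ doublyStochastic ℝ (Fin n)) {μ : Fin n → ℝ} (hμ : μ ∈ Γ) :
    M.mulVec μ ∈ Γ ∧ f μ ≤ f (M.mulVec μ) := by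
  have hts : {y | ∃ σ : Equiv.Perm (Fin n), y = μ ∘ σ} ⊆ Γ := by
    rintro _ ⟨σ, rfl⟩; exact hΓ σ μ hμ
  have hmem : M.mulVec μ ∈ convexHull ℝ {y | ∃ σ : Equiv.Perm (Fin n), y = μ ∘ σ} := by
    obtain ⟨w, hw, hw1, rfl⟩ := exists_eq_sum_perm_of_mem_doublyStochastic hM
    rw [Matrix.sum_mulVec]
    simp only [Matrix.smul_mulVec, Matrix.permMatrix_mulVec]
    exact (convex_convexHull ℝ _).sum_mem (fun σ _ => hw σ) hw1
      fun σ _ => subset_convexHull ℝ _ ⟨σ, rfl⟩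
  refine ⟨convexHull_min hts hc.1 hmem, ?_⟩
  obtain ⟨_, ⟨σ, rfl⟩, hy⟩ := hc.exists_le_of_mem_convexHull hts hmem
  rwa [hf σ μ hμ] at hy

lemma sq_mem_doublyStochastic {n : ℕ} {Q : Mat n} (hQ : Q.transpose * Q = 1) :
    (Matrix.of fun i j => Q i j ^ 2) ∈ doublyStochastic ℝ (Fin n) := by
  rw [mem_doublyStochastic_iff_sum]
  have hQ' : Q * Q.transpose = 1 := mul_eq_one_comm.1 hQ
  refine ⟨fun i j => sq_nonneg _, fun i => ?_, fun j => ?_⟩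
  · have := congrFun (congrFun hQ' i) i
    rw [Matrix.mul_apply, Matrix.one_apply_eq] at this
    simpa [sq] using this
  · have := congrFun (congrFun hQ j) j
    rw [Matrix.mul_apply, Matrix.one_apply_eq] at this
    simpa [sq] using this

/-- Schur's theorem for a concave symmetric function. -/
lemma IsOrthDiag.mem_and_le_diagonal {n : ℕ} {Γ : Set (Fin n → ℝ)}
    {f : (Fin n → ℝ) → ℝ} (hΓ : ∀ σ : Equiv.Perm (Fin n), ∀ lam ∈ Γ, lam ∘ σ ∈ Γ)
    (hf : ∀ σ : Equiv.Perm (Fin n), ∀ lam ∈ Γ, f (lam ∘ σ) = f lam) (hc : ConcaveOn ℝ Γ f)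
    {S W V : Mat n} {μ : Fin n → ℝ} (h : IsOrthDiag S W μ) (hμ : μ ∈ Γ)
    (hV : V.transpose * V = 1) :
    (fun i => ∑ a, ∑ b, V a i * V b i * S a b) ∈ Γ ∧
      f μ ≤ f (fun i => ∑ a, ∑ b, V a i * V b i * S a b) := by
  have hV' : V * V.transpose = 1 := mul_eq_one_comm.1 hV
  have hQ : (V.transpose * W).transpose * (V.transpose * W) = 1 := by
    rw [Matrix.transpose_mul, Matrix.transpose_transpose]
    calc _ = W.transpose * (V * V.transpose) * W := by simp only [mul_assoc]
      _ = 1 := by rw [hV', mul_one, h.1]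
  have key : (fun i => ∑ a, ∑ b, V a i * V b i * S a b)
      = (Matrix.of fun i j => (V.transpose * W) i j ^ 2 : Mat n).mulVec μ := by
    funext i
    have e : V.transpose * S * V = (V.transpose * W) * Matrix.diagonal μ
        * (V.transpose * W).transpose := by
      rw [h.2, Matrix.transpose_mul, Matrix.transpose_transpose]
      simp only [mul_assoc]
    rw [← transpose_mul_mul_apply_self, e, conj_diagonal_apply]
    simp only [Matrix.mulVec, dotProduct, Matrix.of_apply]
    exact Finset.sum_congr rfl fun l _ => by ring
  rw [key]
  exact mulVec_mem_and_le_of_doublyStochastic hΓ hf hc (sq_mem_doublyStochastic hQ) hμ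

lemma fderiv_eq_sum_fLam {n : ℕ} (f : (Fin n → ℝ) → ℝ) (x v : Fin n → ℝ) :
    fderiv ℝ f x v = ∑ i, fLam f x i * v i := by
  conv_lhs => rw [pi_eq_sum_univ' v, map_sum]
  refine Finset.sum_congr rfl fun i _ => ?_
  rw [map_smul, smul_eq_mul, mul_comm, fLam]

/-- A concave function lies below its tangent planes. -/
lemma _root_.ConcaveOn.le_add_fderiv {E : Type*} [NormedAddCommGroup E] [NormedSpace ℝ E]
    {s : Set E} {f : E → ℝ} (hf : ConcaveOn ℝ s f) {x y : E} (hx : x ∈ s) (hy : y ∈ s)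
    (hd : DifferentiableAt ℝ f x) : f y ≤ f x + fderiv ℝ f x (y - x) := by
  have h1 := hf.comp_affineMap (AffineMap.lineMap x y)
  have h2 : HasDerivAt (f ∘ (AffineMap.lineMap x y : ℝ →ᵃ[ℝ] E)) (fderiv ℝ f x (y - x)) 0 := by
    have h3 : HasFDerivAt f (fderiv ℝ f x) ((AffineMap.lineMap x y : ℝ →ᵃ[ℝ] E) 0) := by
      simpa using hd.hasFDerivAt
    exact h3.comp_hasDerivAt 0 AffineMap.hasDerivAt_lineMap
  have h4 := h1.slope_le_of_hasDerivAt (x := 0) (y := 1) (by simpa using hx) (by simpa using hy)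
    one_pos h2
  simp only [slope_def_field, Function.comp_apply, AffineMap.lineMap_apply_one,
    AffineMap.lineMap_apply_zero, sub_zero, div_one] at h4
  linarith

lemma fLam_comp_perm {n : ℕ} {Γ : Set (Fin n → ℝ)} (ho : IsOpen Γ) {f : (Fin n → ℝ) → ℝ}
    (hΓ : ∀ σ : Equiv.Perm (Fin n), ∀ lam ∈ Γ, lam ∘ σ ∈ Γ)
    (hf : ∀ σ : Equiv.Perm (Fin n), ∀ lam ∈ Γ, f (lam ∘ σ) = f lam)
    (hd : ∀ lam ∈ Γ, DifferentiableAt ℝ f lam)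
    (σ : Equiv.Perm (Fin n)) {μ : Fin n → ℝ} (hμ : μ ∈ Γ) (i : Fin n) :
    fLam f (μ ∘ σ) i = fLam f μ (σ i) := by
  have h1 : (fun y => f (y ∘ σ)) =ᶠ[𝓝 μ] f := by
    filter_upwards [ho.mem_nhds hμ] with y hy using hf σ y hy
  let L : (Fin n → ℝ) →L[ℝ] (Fin n → ℝ) :=
    ContinuousLinearMap.pi fun j => ContinuousLinearMap.proj (σ j)
  have h2 : HasFDerivAt (fun y => f (L y)) ((fderiv ℝ f (μ ∘ σ)).comp L) μ :=
    HasFDerivAt.comp μ (hd _ (hΓ σ μ hμ)).hasFDerivAt L.hasFDerivAt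
  have h3 : HasFDerivAt f ((fderiv ℝ f (μ ∘ σ)).comp L) μ := h2.congr_of_eventuallyEq h1.symm
  rw [fLam, fLam, h3.fderiv, ContinuousLinearMap.comp_apply]
  congr 1
  ext j
  simp [L, Pi.single_apply]

lemma specGrad_unique {n : ℕ} {Γ : Set (Fin n → ℝ)} (ho : IsOpen Γ) {f : (Fin n → ℝ) → ℝ}
    (hΓ : ∀ σ : Equiv.Perm (Fin n), ∀ lam ∈ Γ, lam ∘ σ ∈ Γ)
    (hf : ∀ σ : Equiv.Perm (Fin n), ∀ lam ∈ Γ, f (lam ∘ σ) = f lam)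
    (hd : ∀ lam ∈ Γ, DifferentiableAt ℝ f lam)
    {S W V : Mat n} {μ ν : Fin n → ℝ} (h : IsOrthDiag S W μ) (h' : IsOrthDiag S V ν)
    (hμ : μ ∈ Γ) : ν ∈ Γ ∧ specGrad f W μ = specGrad f V ν := by
  obtain ⟨σ, hσ⟩ := h.exists_perm
  obtain ⟨τ, hτ⟩ := h'.exists_perm
  have hν : ν = μ ∘ (τ.symm.trans σ : Equiv.Perm (Fin n)) := by
    have : ν = (ν ∘ τ) ∘ τ.symm := by ext; simp
    rw [this, ← hτ, hσ]; rfl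
  generalize (τ.symm.trans σ : Equiv.Perm (Fin n)) = ρ at hν
  have hV' : V * V.transpose = 1 := mul_eq_one_comm.1 h'.1
  have hW' : W * W.transpose = 1 := mul_eq_one_comm.1 h.1
  refine ⟨hν ▸ hΓ ρ μ hμ, ?_⟩
  have hQ : (V.transpose * W) * Matrix.diagonal μ = Matrix.diagonal ν * (V.transpose * W) := by
    calc _ = V.transpose * (W * Matrix.diagonal μ * W.transpose) * W := by
          simp only [mul_assoc, h.1, mul_one]
      _ = V.transpose * (V * Matrix.diagonal ν * V.transpose) * W := by rw [← h.2, ← h'.2]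
      _ = (V.transpose * V) * Matrix.diagonal ν * (V.transpose * W) := by simp only [mul_assoc]
      _ = _ := by rw [h'.1, one_mul]
  have hQf : (V.transpose * W) * Matrix.diagonal (fLam f μ)
      = Matrix.diagonal (fLam f ν) * (V.transpose * W) := by
    ext i j
    have hij := congrFun (congrFun hQ i) j
    rw [Matrix.mul_diagonal, Matrix.diagonal_mul] at hij ⊢
    by_cases h0 : (V.transpose * W) i j = 0
    · simp [h0]
    have hji : μ j = ν i := by
      rw [mul_comm] at hij
      exact mul_right_cancel₀ h0 hij
    have hsw : μ ∘ (Equiv.swap j (ρ i)) = μ := by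
      ext l
      have hρ : μ (ρ i) = μ j := by rw [hji, hν]; rfl
      simp only [Function.comp_apply]
      rcases eq_or_ne l j with rfl | h1
      · simp [hρ]
      rcases eq_or_ne l (ρ i) with rfl | h2
      · simp [hρ]
      rw [Equiv.swap_apply_of_ne_of_ne h1 h2]
    have h5 := fLam_comp_perm ho hΓ hf hd (Equiv.swap j (ρ i)) hμ j
    rw [hsw, Equiv.swap_apply_left] at h5
    rw [hν, fLam_comp_perm ho hΓ hf hd ρ hμ i, h5, mul_comm]
  unfold specGrad
  calc _ = (V * V.transpose) * W * Matrix.diagonal (fLam f μ) * W.transpose := by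
        rw [hV', one_mul]
    _ = V * ((V.transpose * W) * Matrix.diagonal (fLam f μ)) * W.transpose := by
        simp only [mul_assoc]
    _ = V * Matrix.diagonal (fLam f ν) * V.transpose * (W * W.transpose) := by
        rw [hQf]; simp only [mul_assoc]
    _ = _ := by rw [hW', mul_one]

lemma continuous_conj_diagonal (n : ℕ) : Continuous fun p : Mat n × (Fin n → ℝ) =>
    p.1 * Matrix.diagonal p.2 * p.1.transpose :=
  (continuous_fst.matrix_mul continuous_snd.matrix_diagonal).matrix_mul
    continuous_fst.matrix_transpose

lemma continuousOn_specGrad {n : ℕ} {Γ : Set (Fin n → ℝ)} (ho : IsOpen Γ)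
    {f : (Fin n → ℝ) → ℝ} (hd : ContDiffOn ℝ 1 f Γ) :
    ContinuousOn (fun p : Mat n × (Fin n → ℝ) => specGrad f p.1 p.2) (Set.univ ×ˢ Γ) := by
  have h1 : ContinuousOn (fderiv ℝ f) Γ := hd.continuousOn_fderiv_of_isOpen ho le_rfl
  have h2 : ContinuousOn (fun x => fLam f x) Γ := by
    refine continuousOn_pi.2 fun i => ?_
    unfold fLam
    exact h1.clm_apply continuousOn_const
  have h3 : ContinuousOn (fun p : Mat n × (Fin n → ℝ) => fLam f p.2) (Set.univ ×ˢ Γ) :=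
    ContinuousOn.comp (g := fun x => fLam f x) h2 continuousOn_snd fun p hp => hp.2
  have h4 : ContinuousOn (fun p : Mat n × (Fin n → ℝ) => (p.1, fLam f p.2)) (Set.univ ×ˢ Γ) :=
    continuousOn_fst.prodMk h3
  unfold specGrad
  exact Continuous.comp_continuousOn (f := fun p : Mat n × (Fin n → ℝ) => (p.1, fLam f p.2))
    (continuous_conj_diagonal n) h4

lemma eventually_forall_mem_of_fiber {X Y : Type*} [TopologicalSpace X] [TopologicalSpace Y]
    [T2Space Y] {K G : Set X} (hK : IsCompact K) (hG : IsOpen G) {Φ : X → Y}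
    (hΦ : Continuous Φ) {y : Y} (h : ∀ x ∈ K, Φ x = y → x ∈ G) :
    ∀ᶠ z in 𝓝 y, ∀ x ∈ K, Φ x = z → x ∈ G := by
  have hB : IsClosed (Φ '' (K \ G)) := ((hK.diff hG).image hΦ).isClosed
  have hy : y ∉ Φ '' (K \ G) := by
    rintro ⟨x, ⟨hx, hn⟩, hxy⟩
    exact hn (h x hx hxy)
  filter_upwards [hB.isOpen_compl.mem_nhds hy] with z hz x hx hxz
  by_contra hn
  exact hz ⟨x, ⟨hx, hn⟩, hxz⟩

/-- Orthogonal diagonalizations of matrices close to `U` have eigenvalues in `Γ` and spectral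
gradient close to that of `U`. -/
lemma eventually_specGrad_close {n : ℕ} {Γ : Set (Fin n → ℝ)} (ho : IsOpen Γ)
    {f : (Fin n → ℝ) → ℝ}
    (hΓ : ∀ σ : Equiv.Perm (Fin n), ∀ lam ∈ Γ, lam ∘ σ ∈ Γ)
    (hf : ∀ σ : Equiv.Perm (Fin n), ∀ lam ∈ Γ, f (lam ∘ σ) = f lam)
    (hd : ContDiffOn ℝ 1 f Γ) {U V : Mat n} {lam : Fin n → ℝ} (hU : IsOrthDiag U V lam)
    (hlam : lam ∈ Γ) {ε : ℝ} (hε : 0 < ε) :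
    ∀ᶠ S in 𝓝 U, ∀ (W : Mat n) (μ : Fin n → ℝ), IsOrthDiag S W μ →
      μ ∈ Γ ∧ ∀ i j, |specGrad f W μ i j - specGrad f V lam i j| < ε := by
  have hdiff : ∀ lam ∈ Γ, DifferentiableAt ℝ f lam := fun l hl =>
    (hd.contDiffAt (ho.mem_nhds hl)).differentiableAt one_ne_zero
  obtain ⟨R, hR⟩ : ∃ R : ℝ, ∀ i j, |U i j| < R := by
    refine ⟨1 + ∑ i, ∑ j, |U i j|, fun i j => ?_⟩
    have h1 := Finset.single_le_sum (f := fun j => |U i j|)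
      (fun _ _ => abs_nonneg _) (Finset.mem_univ j)
    have h2 := Finset.single_le_sum (f := fun i => ∑ j, |U i j|)
      (fun _ _ => Finset.sum_nonneg fun _ _ => abs_nonneg _) (Finset.mem_univ i)
    have h3 : |U i j| ≤ ∑ i, ∑ j, |U i j| := h1.trans h2
    linarith
  let box : Set (Mat n) := Set.univ.pi fun _ => Set.univ.pi fun _ => Set.Icc (-1) 1
  let Kc : Set (Mat n × (Fin n → ℝ)) :=
    (box ∩ {W | W.transpose * W = 1}) ×ˢ Set.univ.pi fun _ => Set.Icc (-(n * (n * R))) (n * (n * R))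
  have hKc : IsCompact Kc := by
    refine IsCompact.prod (IsCompact.inter_right ?_ ?_) (isCompact_univ_pi fun _ => isCompact_Icc)
    · exact isCompact_univ_pi fun _ => isCompact_univ_pi fun _ => isCompact_Icc
    · exact isClosed_eq (continuous_id.matrix_transpose.matrix_mul continuous_id) continuous_const
  let G : Set (Mat n × (Fin n → ℝ)) :=
    (Set.univ ×ˢ Γ) ∩ (fun p => specGrad f p.1 p.2) ⁻¹'
      {H | ∀ i j, |H i j - specGrad f V lam i j| < ε}
  have hG : IsOpen G := by
    refine ContinuousOn.isOpen_inter_preimage ?_ (isOpen_univ.prod ho) ?_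
    · exact continuousOn_specGrad ho hd
    · simp only [Set.ofPred_forall]
      refine isOpen_iInter_of_finite fun i => isOpen_iInter_of_finite fun j => ?_
      exact isOpen_lt ((continuous_id.matrix_elem i j).sub continuous_const).abs continuous_const
  have hfib := eventually_forall_mem_of_fiber hKc hG (continuous_conj_diagonal n) (y := U) (by
    rintro ⟨W, μ⟩ hK hΦU
    have h2 := specGrad_unique ho hΓ hf hdiff hU ⟨hK.1.2, hΦU.symm⟩ hlam
    refine ⟨⟨trivial, h2.1⟩, fun i j => ?_⟩
    change |specGrad f W μ i j - specGrad f V lam i j| < ε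
    rw [← h2.2, sub_self, abs_zero]
    exact hε)
  have hsmall : ∀ᶠ S in 𝓝 U, ∀ i j, |S i j| < R := by
    refine Filter.eventually_all.2 fun i => Filter.eventually_all.2 fun j => ?_
    have hc : Continuous fun S : Mat n => |S i j| := (continuous_id.matrix_elem i j).abs
    exact hc.continuousAt.eventually_lt continuousAt_const (hR i j)
  filter_upwards [hfib, hsmall] with S hS hSR W μ hW
  have hWK : (W, μ) ∈ Kc := by
    refine ⟨⟨fun i _ j _ => abs_le.1 (abs_le_one_of_orth hW.1 i j), hW.1⟩, fun i _ => abs_le.1 ?_⟩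
    simp only
    rw [← hW.diagonal_eq i]
    refine (Finset.abs_sum_le_sum_abs _ _).trans ?_
    refine (Finset.sum_le_card_nsmul _ _ (n * R) fun a _ => ?_).trans (by simp)
    refine (Finset.abs_sum_le_sum_abs _ _).trans ?_
    refine (Finset.sum_le_card_nsmul _ _ R fun b _ => ?_).trans (by simp)
    rw [abs_mul, abs_mul]
    have h1 := abs_le_one_of_orth hW.1 a i
    have h2 := abs_le_one_of_orth hW.1 b i
    have h3 := mul_le_one₀ h1 (abs_nonneg _) h2
    calc _ ≤ 1 * |S a b| := mul_le_mul_of_nonneg_right h3 (abs_nonneg _)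
      _ ≤ R := by rw [one_mul]; exact (hSR a b).le
  have hWG : (W, μ) ∈ G := hS _ hWK hW.2.symm
  exact ⟨hWG.1.2, hWG.2⟩

lemma sum_fLam_mul_diagonal {n : ℕ} (f : (Fin n → ℝ) → ℝ) (W : Mat n) (μ : Fin n → ℝ)
    (H : Fin n → Fin n → ℝ) :
    ∑ i, fLam f μ i * ∑ a, ∑ b, W a i * W b i * H a b
      = ∑ a, ∑ b, specGrad f W μ a b * H a b := by
  simp only [specGrad, conj_diagonal_apply, Finset.mul_sum, Finset.sum_mul]
  rw [Finset.sum_comm]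
  refine Finset.sum_congr rfl fun a _ => ?_
  rw [Finset.sum_comm]
  refine Finset.sum_congr rfl fun b _ => Finset.sum_congr rfl fun i _ => ?_
  ring

lemma specGrad_comm {n : ℕ} (f : (Fin n → ℝ) → ℝ) (W : Mat n) (μ : Fin n → ℝ) (i j : Fin n) :
    specGrad f W μ i j = specGrad f W μ j i := by
  simp only [specGrad, conj_diagonal_apply, mul_comm (W i _)]

/-- The linear functional `H ↦ ∑ g_{ij} H_{ij}`. -/
def pairCLM {n : ℕ} (g : Mat n) : (Fin n → Fin n → ℝ) →L[ℝ] ℝ :=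
  ∑ i, ∑ j, g i j • (ContinuousLinearMap.proj (R := ℝ) (φ := fun _ : Fin n => ℝ) j).comp
    (ContinuousLinearMap.proj (R := ℝ) (φ := fun _ : Fin n => Fin n → ℝ) i)

lemma pairCLM_apply {n : ℕ} (g : Mat n) (H : Fin n → Fin n → ℝ) :
    pairCLM g H = ∑ i, ∑ j, g i j * H i j := by
  simp [pairCLM]

lemma pairCLM_single {n : ℕ} (g : Mat n) (i j : Fin n) :
    pairCLM g (Pi.single i (Pi.single j 1)) = g i j := by
  rw [pairCLM_apply, Finset.sum_eq_single i, Finset.sum_eq_single j]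
  · simp
  · intro b _ hb; simp [hb]
  · simp
  · intro b _ hb; simp [hb]
  · simp

/-- The linear map sending `H` to the diagonal of `Vᵀ H V`. -/
def diagCLM {n : ℕ} (V : Mat n) : (Fin n → Fin n → ℝ) →L[ℝ] (Fin n → ℝ) :=
  ContinuousLinearMap.pi fun i => pairCLM (Matrix.of fun a b => V a i * V b i)

lemma diagCLM_apply {n : ℕ} (V : Mat n) (H : Fin n → Fin n → ℝ) :
    diagCLM V H = fun i => ∑ a, ∑ b, V a i * V b i * H a b := by
  funext i
  simp [diagCLM, pairCLM_apply]

/-- The symmetric part of a matrix. -/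
def symPart {n : ℕ} (h : Fin n → Fin n → ℝ) : Mat n := Matrix.of fun i j => (h i j + h j i) / 2

lemma symPart_isHermitian {n : ℕ} (h : Fin n → Fin n → ℝ) : (symPart h).IsHermitian := by
  ext i j
  simp [symPart, add_comm]

lemma symPart_of_isHermitian {n : ℕ} {U : Mat n} (hU : U.IsHermitian) :
    symPart (fun a b => U a b) = U := by
  ext i j
  have := hU.apply i j
  simp only [star_trivial] at this
  simp [symPart, this]

lemma continuous_symPart (n : ℕ) : Continuous (symPart (n := n)) :=
  continuous_matrix fun i j => by
    simp only [symPart, Matrix.of_apply]; fun_prop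

lemma sum_mul_symPart {n : ℕ} {g : Mat n} (hg : ∀ i j, g i j = g j i) (h : Fin n → Fin n → ℝ) :
    ∑ a, ∑ b, g a b * symPart h a b = ∑ a, ∑ b, g a b * h a b := by
  have h1 : ∑ a, ∑ b, g a b * h b a = ∑ a, ∑ b, g a b * h a b := by
    rw [Finset.sum_comm]
    exact Finset.sum_congr rfl fun a _ => Finset.sum_congr rfl fun b _ => by rw [hg]
  have h2 : ∑ a, ∑ b, g a b * symPart h a b
      = (∑ a, ∑ b, g a b * h a b + ∑ a, ∑ b, g a b * h b a) / 2 := by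
    simp only [← Finset.sum_add_distrib, Finset.sum_div]
    refine Finset.sum_congr rfl fun a _ => Finset.sum_congr rfl fun b _ => ?_
    simp only [symPart, Matrix.of_apply]; ring
  rw [h2, h1]; ring

/-- A concave symmetric `C¹` function of the eigenvalues is differentiable. -/
lemma hasFDerivAt_Ffunc {n : ℕ} {Γ : Set (Fin n → ℝ)} (ho : IsOpen Γ)
    {f : (Fin n → ℝ) → ℝ}
    (hΓ : ∀ σ : Equiv.Perm (Fin n), ∀ lam ∈ Γ, lam ∘ σ ∈ Γ)
    (hf : ∀ σ : Equiv.Perm (Fin n), ∀ lam ∈ Γ, f (lam ∘ σ) = f lam)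
    (hd : ContDiffOn ℝ 1 f Γ) (hc : ConcaveOn ℝ Γ f) {U V : Mat n}
    (hV : IsOrthDiag U V (eigenVec U)) (hlam : eigenVec U ∈ Γ) :
    HasFDerivAt (Ffunc f) (pairCLM (specGrad f V (eigenVec U))) (fun a b => U a b) := by
  have hdiff : ∀ lam ∈ Γ, DifferentiableAt ℝ f lam := fun l hl =>
    (hd.contDiffAt (ho.mem_nhds hl)).differentiableAt one_ne_zero
  have hUs := symPart_of_isHermitian hV.isHermitian
  have hdU : diagCLM V (fun a b => U a b) = eigenVec U := by
    rw [diagCLM_apply]; funext i; exact hV.diagonal_eq i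
  set U₀ : Fin n → Fin n → ℝ := fun a b => U a b with hU₀
  have hUab : ∀ a b, U a b = (U₀ a b + U₀ b a) / 2 := fun a b =>
    (congrFun (congrFun hUs a) b).symm
  have hFU : Ffunc f U₀ = f (eigenVec U) := by
    change f (eigenVec (symPart U₀)) = _
    rw [hUs]
  have hG : HasFDerivAt (fun h => f (diagCLM V h)) (pairCLM (specGrad f V (eigenVec U))) U₀ := by
    have h1 : HasFDerivAt f (fderiv ℝ f (eigenVec U)) (diagCLM V U₀) := by
      rw [hdU]; exact (hdiff _ hlam).hasFDerivAt
    have h2 := h1.comp U₀ (diagCLM V).hasFDerivAt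
    have h3 : pairCLM (specGrad f V (eigenVec U))
        = (fderiv ℝ f (eigenVec U)).comp (diagCLM V) := by
      ext1 H
      rw [ContinuousLinearMap.comp_apply, fderiv_eq_sum_fLam, diagCLM_apply, pairCLM_apply,
        sum_fLam_mul_diagonal]
    rw [h3]; exact h2
  rw [hasFDerivAt_iff_isLittleO, Asymptotics.isLittleO_iff] at hG ⊢
  intro c hc0
  set g := specGrad f V (eigenVec U) with hg
  have hε : 0 < c / (n * n + 1) := by positivity
  have hnear := eventually_specGrad_close ho hΓ hf hd hV hlam hε
  have hcont : Filter.Tendsto symPart (𝓝 U₀) (𝓝 U) := by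
    have := (continuous_symPart n).tendsto U₀
    rwa [hUs] at this
  filter_upwards [hG hc0, hcont.eventually hnear] with h hGh hh
  obtain ⟨W, hW⟩ := isOrthDiag_eigenVec (symPart_isHermitian h)
  obtain ⟨hμ, hclose⟩ := hh W _ hW
  rw [hdU] at hGh
  rw [hFU]
  have hF : Ffunc f h = f (eigenVec (symPart h)) := rfl
  rw [hF]
  set S := symPart h with hS
  rw [Real.norm_eq_abs, abs_le] at hGh ⊢
  have hupper : f (eigenVec S) ≤ f (diagCLM V h) := by
    have h1 := (hW.mem_and_le_diagonal hΓ hf hc hμ hV.1).2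
    convert h1 using 2
    rw [diagCLM_apply]
    funext i
    exact (sum_mul_symPart (g := Matrix.of fun a b => V a i * V b i)
      (fun a b => by simp [mul_comm]) h).symm
  have hpair : pairCLM g (h - U₀) = ∑ a, ∑ b, g a b * (S a b - U a b) := by
    rw [pairCLM_apply, ← sum_mul_symPart (fun i j => specGrad_comm _ _ _ _ _)]
    refine Finset.sum_congr rfl fun a _ => Finset.sum_congr rfl fun b _ => ?_
    congr 1
    rw [hS]
    rw [hUab]
    simp only [symPart, Matrix.of_apply, Pi.sub_apply]; ring
  have hSU : ∀ a b, |S a b - U a b| ≤ ‖h - U₀‖ := by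
    intro a b
    have e : S a b - U a b = ((h - U₀) a b + (h - U₀) b a) / 2 := by
      rw [hS]
      rw [hUab]
      simp only [symPart, Matrix.of_apply, Pi.sub_apply]; ring
    have hn : ∀ a b, |(h - U₀) a b| ≤ ‖h - U₀‖ := fun a b =>
      (norm_le_pi_norm ((h - U₀) a) b).trans (norm_le_pi_norm (h - U₀) a)
    have h1 := abs_le.1 (hn a b)
    have h2 := abs_le.1 (hn b a)
    rw [e, abs_le]
    constructor <;> linarith
  have hlower : f (eigenVec U) ≤ f (eigenVec S)
      + ∑ a, ∑ b, specGrad f W (eigenVec S) a b * (U a b - S a b) := by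
    obtain ⟨hm, hle⟩ := hV.mem_and_le_diagonal hΓ hf hc hlam hW.1
    have h1 := hc.le_add_fderiv hμ hm (hdiff _ hμ)
    rw [fderiv_eq_sum_fLam] at h1
    rw [← sum_fLam_mul_diagonal f W (eigenVec S) (fun a b => U a b - S a b)]
    refine hle.trans (h1.trans_eq ?_)
    congr 1
    refine Finset.sum_congr rfl fun i _ => ?_
    congr 1
    rw [Pi.sub_apply, ← hW.diagonal_eq i]
    simp only [← Finset.sum_sub_distrib, mul_sub]
  have herr : |∑ a, ∑ b, (specGrad f W (eigenVec S) a b - g a b) * (U a b - S a b)|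
      ≤ c * ‖h - U₀‖ := by
    refine (Finset.abs_sum_le_sum_abs _ _).trans ?_
    have hb : ∀ a ∈ Finset.univ,
        |∑ b, (specGrad f W (eigenVec S) a b - g a b) * (U a b - S a b)|
          ≤ n * (c / (n * n + 1) * ‖h - U₀‖) := by
      intro a _
      refine (Finset.abs_sum_le_sum_abs _ _).trans ?_
      refine (Finset.sum_le_card_nsmul _ _ (c / (n * n + 1) * ‖h - U₀‖) fun b _ => ?_).trans
        (by simp)
      rw [abs_mul, abs_sub_comm (U a b)]
      exact mul_le_mul (hclose a b).le (hSU a b) (abs_nonneg _) hε.le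
    refine (Finset.sum_le_card_nsmul _ _ _ hb).trans ?_
    rw [Finset.card_univ, Fintype.card_fin, nsmul_eq_mul]
    have : (n : ℝ) * (n * (c / (n * n + 1) * ‖h - U₀‖))
        = (n * n / (n * n + 1)) * (c * ‖h - U₀‖) := by ring
    rw [this]
    refine mul_le_of_le_one_left (by positivity) ?_
    rw [div_le_one (by positivity)]
    linarith
  have hsplit : ∑ a, ∑ b, specGrad f W (eigenVec S) a b * (U a b - S a b)
      = ∑ a, ∑ b, (specGrad f W (eigenVec S) a b - g a b) * (U a b - S a b)
        - ∑ a, ∑ b, g a b * (S a b - U a b) := by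
    simp only [← Finset.sum_sub_distrib]
    exact Finset.sum_congr rfl fun a _ => Finset.sum_congr rfl fun b _ => by ring
  have herr' := abs_le.1 herr
  rw [hpair] at hGh ⊢
  constructor
  · linarith
  · linarith

lemma abs_specGrad_le {n : ℕ} {f : (Fin n → ℝ) → ℝ} {W : Mat n} {μ : Fin n → ℝ}
    (hW : W.transpose * W = 1) (hf : ∀ i, 0 ≤ fLam f μ i) (i j : Fin n) :
    |specGrad f W μ i j| ≤ ∑ l, fLam f μ l := by
  rw [specGrad, conj_diagonal_apply]
  refine (Finset.abs_sum_le_sum_abs _ _).trans (Finset.sum_le_sum fun l _ => ?_)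
  rw [abs_mul, abs_mul, abs_of_nonneg (hf l)]
  exact mul_le_of_le_one_right (hf l) (mul_le_one₀ (abs_le_one_of_orth hW i l) (abs_nonneg _)
    (abs_le_one_of_orth hW j l))

lemma Fmat_eq_of_hasFDerivAt {n : ℕ} {f : (Fin n → ℝ) → ℝ} {U g : Mat n}
    (h : HasFDerivAt (Ffunc f) (pairCLM g) (fun a b => U a b)) : Fmat f U = g := by
  ext i j
  rw [Fmat, Matrix.of_apply, h.fderiv, pairCLM_single]

/-- `F` is differentiable at `U`, and its derivative is bounded by `∑ f_i`. -/
lemma hasFDerivAt_Ffunc_and_abs_Fmat_le {n : ℕ} {Γ : Set (Fin n → ℝ)} {f : (Fin n → ℝ) → ℝ}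
    (hΓ : GoodCone Γ) (hf : SmoothSymF Γ f) (h1 : F1cond Γ f) (h2 : F2cond Γ f) {U : Mat n}
    (hU : U.IsHermitian) (hlam : eigenVec U ∈ Γ) :
    HasFDerivAt (Ffunc f) (pairCLM (Fmat f U)) (fun a b => U a b) ∧
      ∀ i j, |Fmat f U i j| ≤ ∑ l, fLam f (eigenVec U) l := by
  obtain ⟨V, hV⟩ := isOrthDiag_eigenVec hU
  have h := hasFDerivAt_Ffunc hΓ.1 hΓ.2.2.2.1 hf.2 (hf.1.of_le (by norm_cast))
    h2 hV hlam
  rw [Fmat_eq_of_hasFDerivAt h]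
  exact ⟨h, abs_specGrad_le hV.1 fun i => (h1 _ hlam i).le⟩

/-- Directional derivative of a function on space-time. -/
def dirD {n : ℕ} (a : (Fin n → ℝ) × ℝ) (w : (Fin n → ℝ) × ℝ → ℝ) (q : (Fin n → ℝ) × ℝ) : ℝ :=
  fderiv ℝ w q a

/-- The `i`-th spatial unit vector of space-time. -/
def spaceDir {n : ℕ} (i : Fin n) : (Fin n → ℝ) × ℝ := (Pi.single i 1, 0)

/-- The temporal unit vector of space-time. -/
def timeDir (n : ℕ) : (Fin n → ℝ) × ℝ := (0, 1)

lemma norm_single_one_le {n : ℕ} (i : Fin n) : ‖(Pi.single i 1 : Fin n → ℝ)‖ ≤ 1 := by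
  rw [pi_norm_le_iff_of_nonneg zero_le_one]
  intro j
  rcases eq_or_ne j i with rfl | h
  · simp
  · simp [h]

lemma norm_spaceDir_le {n : ℕ} (i : Fin n) : ‖spaceDir i‖ ≤ 1 := by
  simpa [spaceDir, Prod.norm_def] using norm_single_one_le i

lemma norm_timeDir_le (n : ℕ) : ‖timeDir n‖ ≤ 1 := by
  simp [timeDir, Prod.norm_def]

lemma ContDiff.dirD {n : ℕ} {m : ℕ} {w : (Fin n → ℝ) × ℝ → ℝ} (h : ContDiff ℝ (m + 1 : ℕ) w)
    (a : (Fin n → ℝ) × ℝ) : ContDiff ℝ m (dirD a w) :=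
  (h.fderiv_right (m := m) (by norm_cast)).clm_apply contDiff_const

lemma dirD_comm {n : ℕ} {w : (Fin n → ℝ) × ℝ → ℝ} (h : ContDiff ℝ 2 w)
    (a b : (Fin n → ℝ) × ℝ) : dirD a (dirD b w) = dirD b (dirD a w) := by
  have key : ∀ (q a b : (Fin n → ℝ) × ℝ),
      dirD a (dirD b w) q = fderiv ℝ (fderiv ℝ w) q a b := by
    intro q a b
    have h1 : DifferentiableAt ℝ (fderiv ℝ w) q :=
      (h.fderiv_right (m := 1) (by norm_num)).differentiable one_ne_zero q
    have h2 := h1.hasFDerivAt.clm_apply (hasFDerivAt_const b q)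
    change fderiv ℝ (fun y => fderiv ℝ w y b) q a = _
    rw [h2.fderiv]
    simp
  funext q
  rw [key, key]
  exact h.contDiffAt.isSymmSndFDerivAt (by simp) a b

lemma norm_iteratedFDeriv_dirD_le {n : ℕ} {m : ℕ} {w : (Fin n → ℝ) × ℝ → ℝ}
    (h : ContDiff ℝ (m + 1 : ℕ) w) {a : (Fin n → ℝ) × ℝ} (ha : ‖a‖ ≤ 1)
    (q : (Fin n → ℝ) × ℝ) :
    ‖iteratedFDeriv ℝ m (dirD a w) q‖ ≤ ‖iteratedFDeriv ℝ (m + 1) w q‖ := by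
  have h1 : ContDiffAt ℝ m (fderiv ℝ w) q := (h.fderiv_right (m := m) (by norm_cast)).contDiffAt
  have h2 := (ContinuousLinearMap.apply ℝ ℝ a).norm_iteratedFDeriv_comp_left h1 le_rfl
  rw [norm_iteratedFDeriv_fderiv] at h2
  refine h2.trans (mul_le_of_le_one_left (norm_nonneg _) ?_)
  refine ContinuousLinearMap.opNorm_le_bound _ zero_le_one fun L => ?_
  rw [ContinuousLinearMap.apply_apply, one_mul]
  exact (L.le_opNorm a).trans (mul_le_of_le_one_right (norm_nonneg _) ha)

lemma abs_dirD_dirD_le {n : ℕ} {w : (Fin n → ℝ) × ℝ → ℝ} (h : ContDiff ℝ 2 w)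
    {a b : (Fin n → ℝ) × ℝ} (ha : ‖a‖ ≤ 1) (hb : ‖b‖ ≤ 1) (q : (Fin n → ℝ) × ℝ) :
    |dirD a (dirD b w) q| ≤ ‖iteratedFDeriv ℝ 2 w q‖ := by
  have h1 : ContDiff ℝ 1 (dirD b w) := ContDiff.dirD (m := 1) h b
  have e2 := norm_iteratedFDeriv_dirD_le (m := 1) h hb q
  have e1 := norm_iteratedFDeriv_dirD_le (m := 0) h1 ha q
  rw [norm_iteratedFDeriv_zero] at e1
  exact e1.trans e2

lemma abs_dirD_dirD_dirD_le {n : ℕ} {w : (Fin n → ℝ) × ℝ → ℝ} (h : ContDiff ℝ 3 w)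
    {a b c : (Fin n → ℝ) × ℝ} (ha : ‖a‖ ≤ 1) (hb : ‖b‖ ≤ 1) (hc : ‖c‖ ≤ 1)
    (q : (Fin n → ℝ) × ℝ) :
    |dirD a (dirD b (dirD c w)) q| ≤ ‖iteratedFDeriv ℝ 3 w q‖ :=
  (abs_dirD_dirD_le (ContDiff.dirD (m := 2) h c) ha hb q).trans
    (norm_iteratedFDeriv_dirD_le (m := 2) h hc q)

lemma sgrad_slice {n : ℕ} {u : (Fin n → ℝ) → ℝ → ℝ}
    (h : Differentiable ℝ fun q : (Fin n → ℝ) × ℝ => u q.1 q.2) (x : Fin n → ℝ) (t : ℝ)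
    (i : Fin n) :
    sgrad (fun y => u y t) x i = dirD (spaceDir i) (fun q => u q.1 q.2) (x, t) := by
  have h1 := (h (x, t)).hasFDerivAt.comp x
    ((hasFDerivAt_id (𝕜 := ℝ) x).prodMk (hasFDerivAt_const t x))
  have h2 : HasFDerivAt (fun y => u y t) _ x := h1
  rw [sgrad, h2.fderiv]
  simp [dirD, spaceDir]

lemma deriv_slice {n : ℕ} {u : (Fin n → ℝ) → ℝ → ℝ}
    (h : Differentiable ℝ fun q : (Fin n → ℝ) × ℝ => u q.1 q.2) (x : Fin n → ℝ) (t : ℝ) :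
    deriv (u x) t = dirD (timeDir n) (fun q => u q.1 q.2) (x, t) := by
  have h1 := (h (x, t)).hasFDerivAt.comp_hasDerivAt t
    ((hasDerivAt_const t x).prodMk (hasDerivAt_id (𝕜 := ℝ) t))
  have h2 : HasDerivAt (u x) _ t := h1
  rw [h2.deriv]
  simp [dirD, timeDir]

lemma shess_slice {n : ℕ} {u : (Fin n → ℝ) → ℝ → ℝ}
    (h : ContDiff ℝ 2 fun q : (Fin n → ℝ) × ℝ => u q.1 q.2) (x : Fin n → ℝ) (t : ℝ)
    (i j : Fin n) :
    shess (fun y => u y t) x i j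
      = dirD (spaceDir i) (dirD (spaceDir j) (fun q => u q.1 q.2)) (x, t) := by
  have h1 : (fun y => fderiv ℝ (fun y => u y t) y (Pi.single j 1))
      = fun y => dirD (spaceDir j) (fun q => u q.1 q.2) (y, t) :=
    funext fun y => sgrad_slice (h.differentiable two_ne_zero) y t j
  rw [shess, Matrix.of_apply, h1]
  exact sgrad_slice (u := fun y s => dirD (spaceDir j) (fun q => u q.1 q.2) (y, s))
    ((ContDiff.dirD (m := 1) h _).differentiable one_ne_zero) x t i

/-- The operator `∑ F_{ij} ∂_i∂_j + ∑ b_l ∂_l - ∂_t` with coefficients frozen at a point. -/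
def frozenOp {n : ℕ} (F : Mat n) (b : Fin n → ℝ) (v : (Fin n → ℝ) × ℝ → ℝ)
    (q : (Fin n → ℝ) × ℝ) : ℝ :=
  (∑ i, ∑ j, F i j * dirD (spaceDir i) (dirD (spaceDir j) v) q)
    + (∑ l, b l * dirD (spaceDir l) v q) - dirD (timeDir n) v q

lemma dirD_sub {n : ℕ} {v w : (Fin n → ℝ) × ℝ → ℝ} (hv : Differentiable ℝ v)
    (hw : Differentiable ℝ w) (a : (Fin n → ℝ) × ℝ) :
    dirD a (fun q => v q - w q) = fun q => dirD a v q - dirD a w q := by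
  funext q
  rw [dirD, fderiv_fun_sub (hv q) (hw q)]
  rfl

lemma frozenOp_sub {n : ℕ} (F : Mat n) (b : Fin n → ℝ) {v w : (Fin n → ℝ) × ℝ → ℝ}
    (hv : ContDiff ℝ 2 v) (hw : ContDiff ℝ 2 w) (q : (Fin n → ℝ) × ℝ) :
    frozenOp F b (fun q => v q - w q) q = frozenOp F b v q - frozenOp F b w q := by
  have hv1 := hv.differentiable two_ne_zero
  have hw1 := hw.differentiable two_ne_zero
  have hv2 := fun a => (ContDiff.dirD (m := 1) hv a).differentiable one_ne_zero
  have hw2 := fun a => (ContDiff.dirD (m := 1) hw a).differentiable one_ne_zero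
  simp only [frozenOp, dirD_sub hv1 hw1, dirD_sub (hv2 _) (hw2 _), mul_sub,
    Finset.sum_sub_distrib]
  ring

/-- `(x,t,p) ↦ A^{ij}(x,t,p)` as a function of one variable. -/
def unA {n : ℕ} (A : (Fin n → ℝ) → ℝ → (Fin n → ℝ) → Mat n) (i j : Fin n)
    (r : ((Fin n → ℝ) × ℝ) × (Fin n → ℝ)) : ℝ := A r.1.1 r.1.2 r.2 i j

/-- `(x,t,z,p) ↦ ψ(x,t,z,p)` as a function of one variable. -/
def unPsi {n : ℕ} (ψ : (Fin n → ℝ) → ℝ → ℝ → (Fin n → ℝ) → ℝ)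
    (r : ((Fin n → ℝ) × ℝ) × ℝ × (Fin n → ℝ)) : ℝ := ψ r.1.1 r.1.2 r.2.1 r.2.2

/-- The spatial gradient as a function on space-time. -/
def gradD {n : ℕ} (w : (Fin n → ℝ) × ℝ → ℝ) (q : (Fin n → ℝ) × ℝ) : Fin n → ℝ :=
  fun l => dirD (spaceDir l) w q

/-- The first order coefficients of the linearized operator. -/
def driftCoeff {n : ℕ} (A : (Fin n → ℝ) → ℝ → (Fin n → ℝ) → Mat n)
    (ψ : (Fin n → ℝ) → ℝ → ℝ → (Fin n → ℝ) → ℝ) (F : Mat n) (w : (Fin n → ℝ) × ℝ → ℝ)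
    (q : (Fin n → ℝ) × ℝ) (l : Fin n) : ℝ :=
  (∑ i, ∑ j, F i j * fderiv ℝ (unA A i j) (q, gradD w q) (0, Pi.single l 1))
    - fderiv ℝ (unPsi ψ) (q, w q, gradD w q) (0, 0, Pi.single l 1)

lemma Lop_eq_frozenOp {n : ℕ} {f : (Fin n → ℝ) → ℝ}
    {A : (Fin n → ℝ) → ℝ → (Fin n → ℝ) → Mat n} (hA : ASmooth A)
    {ψ : (Fin n → ℝ) → ℝ → ℝ → (Fin n → ℝ) → ℝ} (hψ : PsiSmooth ψ)
    {u v : (Fin n → ℝ) → ℝ → ℝ} (hu : Differentiable ℝ fun q : (Fin n → ℝ) × ℝ => u q.1 q.2)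
    (hv : ContDiff ℝ 2 fun q : (Fin n → ℝ) × ℝ => v q.1 q.2) (x : Fin n → ℝ) (t : ℝ) :
    Lop f A ψ u v x t = frozenOp (Fmat f (Umat A u x t))
      (driftCoeff A ψ (Fmat f (Umat A u x t)) (fun q => u q.1 q.2) (x, t))
      (fun q => v q.1 q.2) (x, t) := by
  have hgrad : sgrad (fun y => u y t) x = gradD (fun q => u q.1 q.2) (x, t) :=
    funext fun l => sgrad_slice hu x t l
  have hAd : ∀ i j p l, fderiv ℝ (fun p => A x t p i j) p (Pi.single l 1)
      = fderiv ℝ (unA A i j) ((x, t), p) (0, Pi.single l 1) := by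
    intro i j p l
    have h0 : Differentiable ℝ (unA A i j) := (hA.2 i j).differentiable (by simp)
    have h1 : HasFDerivAt (fun p => A x t p i j) _ p := (h0 ((x, t), p)).hasFDerivAt.comp p
      ((hasFDerivAt_const (𝕜 := ℝ) (x, t) p).prodMk (hasFDerivAt_id p))
    rw [h1.fderiv]
    simp
  have hψd : ∀ z p l, fderiv ℝ (fun p => ψ x t z p) p (Pi.single l 1)
      = fderiv ℝ (unPsi ψ) ((x, t), z, p) (0, 0, Pi.single l 1) := by
    intro z p l
    have h0 : Differentiable ℝ (unPsi ψ) := hψ.differentiable (by simp)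
    have h1 := (h0 ((x, t), z, p)).hasFDerivAt.comp p
      ((hasFDerivAt_const (𝕜 := ℝ) (x, t) p).prodMk
        ((hasFDerivAt_const (𝕜 := ℝ) z p).prodMk (hasFDerivAt_id p)))
    have h2 : HasFDerivAt (fun p => ψ x t z p) _ p := h1
    rw [h2.fderiv]
    simp
  have hvd := hv.differentiable two_ne_zero
  simp only [Lop, frozenOp, driftCoeff, hAd, hψd, hgrad, shess_slice hv, sgrad_slice hvd,
    deriv_slice hvd]

lemma Umat_apply {n : ℕ} (A : (Fin n → ℝ) → ℝ → (Fin n → ℝ) → Mat n)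
    {u : (Fin n → ℝ) → ℝ → ℝ} (hu : ContDiff ℝ 2 fun q : (Fin n → ℝ) × ℝ => u q.1 q.2)
    (x : Fin n → ℝ) (t : ℝ) (i j : Fin n) :
    Umat A u x t i j = dirD (spaceDir i) (dirD (spaceDir j) fun q => u q.1 q.2) (x, t)
      + unA A i j ((x, t), gradD (fun q => u q.1 q.2) (x, t)) := by
  have hgrad : sgrad (fun y => u y t) x = gradD (fun q => u q.1 q.2) (x, t) :=
    funext fun l => sgrad_slice (hu.differentiable two_ne_zero) x t l
  rw [Umat, Matrix.add_apply, shess_slice hu, hgrad, unA]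

lemma Umat_isHermitian {n : ℕ} {A : (Fin n → ℝ) → ℝ → (Fin n → ℝ) → Mat n} (hA : ASmooth A)
    {u : (Fin n → ℝ) → ℝ → ℝ} (hu : ContDiff ℝ 2 fun q : (Fin n → ℝ) × ℝ => u q.1 q.2)
    (x : Fin n → ℝ) (t : ℝ) : (Umat A u x t).IsHermitian := by
  ext i j
  rw [Matrix.conjTranspose_apply, star_trivial, Umat_apply A hu, Umat_apply A hu,
    dirD_comm hu, unA, unA, (hA.1 _ _ _).apply]

lemma hasDerivAt_line {n : ℕ} {w : (Fin n → ℝ) × ℝ → ℝ} (h : Differentiable ℝ w)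
    (q a : (Fin n → ℝ) × ℝ) : HasDerivAt (fun s : ℝ => w (q + s • a)) (dirD a w q) 0 :=
  (h q).hasFDerivAt.hasLineDerivAt a

lemma sum_smul_single_prod {n : ℕ} (L : (Fin n → ℝ) →L[ℝ] ℝ) (p : Fin n → ℝ) :
    L p = ∑ l, L (Pi.single l 1) * p l := by
  conv_lhs => rw [pi_eq_sum_univ' p, map_sum]
  refine Finset.sum_congr rfl fun i _ => ?_
  rw [map_smul, smul_eq_mul, mul_comm]

/-- Differentiating the equation in a spatial direction. -/
lemma frozenOp_dirD_eq {n : ℕ} {Ω : Set (Fin n → ℝ)} (hΩ : IsOpen Ω) {T : ℝ}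
    {A : (Fin n → ℝ) → ℝ → (Fin n → ℝ) → Mat n} (hA : ASmooth A)
    {ψ : (Fin n → ℝ) → ℝ → ℝ → (Fin n → ℝ) → ℝ} (hψ : PsiSmooth ψ)
    {f : (Fin n → ℝ) → ℝ} {u : (Fin n → ℝ) → ℝ → ℝ} (hu : RegN 3 u)
    (hE : SolvesE f A ψ u (QT Ω T)) {x : Fin n → ℝ} {t : ℝ} (hq : (x, t) ∈ QT Ω T) {F : Mat n}
    (hF : HasFDerivAt (Ffunc f) (pairCLM F) (fun a b => Umat A u x t a b)) (k : Fin n) :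
    frozenOp F (driftCoeff A ψ F (fun q => u q.1 q.2) (x, t))
        (dirD (spaceDir k) fun q => u q.1 q.2) (x, t)
      = fderiv ℝ (unPsi ψ) ((x, t), u x t, gradD (fun q => u q.1 q.2) (x, t))
          (spaceDir k, dirD (spaceDir k) (fun q => u q.1 q.2) (x, t), 0)
        - ∑ i, ∑ j, F i j * fderiv ℝ (unA A i j)
            ((x, t), gradD (fun q => u q.1 q.2) (x, t)) (spaceDir k, 0) := by
  set w : (Fin n → ℝ) × ℝ → ℝ := fun q => u q.1 q.2 with hw
  have hw3 : ContDiff ℝ 3 w := hu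
  have hw2 : ContDiff ℝ 2 w := hw3.of_le (by norm_num)
  have hw1 : Differentiable ℝ w := hw2.differentiable two_ne_zero
  have hD2 : ∀ a, ContDiff ℝ 2 (dirD a w) := fun a => ContDiff.dirD (m := 2) hw3 a
  have hD1 : ∀ a, Differentiable ℝ (dirD a w) := fun a => (hD2 a).differentiable two_ne_zero
  have hDD1 : ∀ a b, Differentiable ℝ (dirD a (dirD b w)) := fun a b =>
    (ContDiff.dirD (m := 1) (hD2 b) a).differentiable one_ne_zero
  have hUs : ∀ q : (Fin n → ℝ) × ℝ,
      Ffunc f (fun i j => dirD (spaceDir i) (dirD (spaceDir j) w) q + unA A i j (q, gradD w q))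
        = f (eigenVec (Umat A u q.1 q.2)) := by
    intro q
    have e : (fun i j => dirD (spaceDir i) (dirD (spaceDir j) w) q + unA A i j (q, gradD w q))
        = fun i j => Umat A u q.1 q.2 i j := by
      funext i j
      exact (Umat_apply A hw2 q.1 q.2 i j).symm
    rw [e]
    change f (eigenVec (symPart _)) = _
    rw [symPart_of_isHermitian (Umat_isHermitian hA hw2 _ _)]
  have hgline : HasDerivAt (fun s : ℝ => gradD w ((x, t) + s • spaceDir k))
      (gradD (dirD (spaceDir k) w) (x, t)) 0 := by
    refine hasDerivAt_pi.2 fun l => ?_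
    have h1 := hasDerivAt_line (hD1 (spaceDir l)) (x, t) (spaceDir k)
    rw [dirD_comm hw2] at h1
    exact h1
  have hqline : HasDerivAt (fun s : ℝ => (x, t) + s • spaceDir k) (spaceDir k) 0 := by
    simpa using ((hasDerivAt_id (0 : ℝ)).smul_const (spaceDir k)).const_add (x, t)
  have hAline : ∀ i j, HasDerivAt
      (fun s : ℝ => unA A i j ((x, t) + s • spaceDir k, gradD w ((x, t) + s • spaceDir k)))
      (fderiv ℝ (unA A i j) ((x, t), gradD w (x, t))
        (spaceDir k, gradD (dirD (spaceDir k) w) (x, t))) 0 := by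
    intro i j
    have h0 : Differentiable ℝ (unA A i j) := (hA.2 i j).differentiable (by simp)
    refine HasFDerivAt.comp_hasDerivAt (l := unA A i j) 0 ?_ (hqline.prodMk hgline)
    simpa using (h0 ((x, t), gradD w (x, t))).hasFDerivAt
  have hψline : HasDerivAt
      (fun s : ℝ => unPsi ψ ((x, t) + s • spaceDir k, w ((x, t) + s • spaceDir k),
        gradD w ((x, t) + s • spaceDir k)))
      (fderiv ℝ (unPsi ψ) ((x, t), w (x, t), gradD w (x, t))
        (spaceDir k, dirD (spaceDir k) w (x, t), gradD (dirD (spaceDir k) w) (x, t))) 0 := by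
    have h0 : Differentiable ℝ (unPsi ψ) := hψ.differentiable (by simp)
    refine HasFDerivAt.comp_hasDerivAt (l := unPsi ψ) 0 ?_
      (hqline.prodMk ((hasDerivAt_line hw1 _ _).prodMk hgline))
    simpa using (h0 ((x, t), w (x, t), gradD w (x, t))).hasFDerivAt
  have hUline : HasDerivAt (fun s : ℝ => fun i j : Fin n =>
      dirD (spaceDir i) (dirD (spaceDir j) w) ((x, t) + s • spaceDir k)
        + unA A i j ((x, t) + s • spaceDir k, gradD w ((x, t) + s • spaceDir k)))
      (fun i j => dirD (spaceDir i) (dirD (spaceDir j) (dirD (spaceDir k) w)) (x, t)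
        + fderiv ℝ (unA A i j) ((x, t), gradD w (x, t))
          (spaceDir k, gradD (dirD (spaceDir k) w) (x, t))) 0 := by
    refine hasDerivAt_pi.2 fun i => hasDerivAt_pi.2 fun j => ?_
    have h1 := hasDerivAt_line (hDD1 (spaceDir i) (spaceDir j)) (x, t) (spaceDir k)
    rw [dirD_comm (hD2 _), dirD_comm hw2 (spaceDir k)] at h1
    exact h1.add (hAline i j)
  have hpt : (fun i j : Fin n =>
      dirD (spaceDir i) (dirD (spaceDir j) w) ((x, t) + (0 : ℝ) • spaceDir k)
        + unA A i j ((x, t) + (0 : ℝ) • spaceDir k, gradD w ((x, t) + (0 : ℝ) • spaceDir k)))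
      = fun a b => Umat A u x t a b := by
    funext i j
    simpa using (Umat_apply A hw2 x t i j).symm
  have hFline := HasFDerivAt.comp_hasDerivAt (l := Ffunc f) (l' := pairCLM F) 0
    (by rw [hpt]; exact hF) hUline
  have hTline := hasDerivAt_line (hD1 (timeDir n)) (x, t) (spaceDir k)
  rw [dirD_comm hw2] at hTline
  have hev : (fun s : ℝ => unPsi ψ ((x, t) + s • spaceDir k, w ((x, t) + s • spaceDir k),
        gradD w ((x, t) + s • spaceDir k))) =ᶠ[𝓝 0] fun s =>
      (Ffunc f ∘ fun s : ℝ => fun i j : Fin n =>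
      dirD (spaceDir i) (dirD (spaceDir j) w) ((x, t) + s • spaceDir k)
        + unA A i j ((x, t) + s • spaceDir k, gradD w ((x, t) + s • spaceDir k))) s
      - dirD (timeDir n) w ((x, t) + s • spaceDir k) := by
    have hc : Continuous fun s : ℝ => x + s • (Pi.single k 1 : Fin n → ℝ) := by fun_prop
    have hmem : ∀ᶠ s : ℝ in 𝓝 0, x + s • (Pi.single k 1 : Fin n → ℝ) ∈ Ω := by
      refine hc.continuousAt.eventually_mem (hΩ.mem_nhds ?_)
      simpa using hq.1
    filter_upwards [hmem] with s hs
    have hqs : (x, t) + s • spaceDir k ∈ QT Ω T := by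
      refine ⟨by simpa [spaceDir] using hs, ?_⟩
      simpa [spaceDir] using hq.2
    simp only [Function.comp_apply]
    generalize (x, t) + s • spaceDir k = q at hqs
    have h1 := hE q hqs
    have hgrad : sgrad (fun y => u y q.2) q.1 = gradD w q :=
      funext fun l => sgrad_slice hw1 q.1 q.2 l
    rw [hgrad, deriv_slice hw1, ← hUs] at h1
    exact h1.symm
  have hfinal := (hψline.congr_of_eventuallyEq hev.symm).unique (hFline.sub hTline)
  have hAs : ∀ i j, fderiv ℝ (unA A i j) ((x, t), gradD w (x, t))
        (spaceDir k, gradD (dirD (spaceDir k) w) (x, t))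
      = fderiv ℝ (unA A i j) ((x, t), gradD w (x, t)) (spaceDir k, 0)
        + ∑ l, fderiv ℝ (unA A i j) ((x, t), gradD w (x, t)) (0, Pi.single l 1)
          * dirD (spaceDir l) (dirD (spaceDir k) w) (x, t) := by
    intro i j
    have h1 := sum_smul_single_prod ((fderiv ℝ (unA A i j) ((x, t), gradD w (x, t))).comp
      (ContinuousLinearMap.inr ℝ ((Fin n → ℝ) × ℝ) (Fin n → ℝ)))
      (gradD (dirD (spaceDir k) w) (x, t))
    simp only [ContinuousLinearMap.comp_apply, ContinuousLinearMap.inr_apply] at h1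
    change _ = _ + ∑ l, _ * gradD (dirD (spaceDir k) w) (x, t) l
    rw [← h1, ← map_add]
    simp
  have hψs : fderiv ℝ (unPsi ψ) ((x, t), w (x, t), gradD w (x, t))
        (spaceDir k, dirD (spaceDir k) w (x, t), gradD (dirD (spaceDir k) w) (x, t))
      = fderiv ℝ (unPsi ψ) ((x, t), w (x, t), gradD w (x, t))
          (spaceDir k, dirD (spaceDir k) w (x, t), 0)
        + ∑ l, fderiv ℝ (unPsi ψ) ((x, t), w (x, t), gradD w (x, t)) (0, 0, Pi.single l 1)
          * dirD (spaceDir l) (dirD (spaceDir k) w) (x, t) := by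
    have h1 := sum_smul_single_prod
      (((fderiv ℝ (unPsi ψ) ((x, t), w (x, t), gradD w (x, t))).comp
        (ContinuousLinearMap.inr ℝ ((Fin n → ℝ) × ℝ) (ℝ × (Fin n → ℝ)))).comp
        (ContinuousLinearMap.inr ℝ ℝ (Fin n → ℝ)))
      (gradD (dirD (spaceDir k) w) (x, t))
    simp only [ContinuousLinearMap.comp_apply, ContinuousLinearMap.inr_apply] at h1
    change _ = _ + ∑ l, _ * gradD (dirD (spaceDir k) w) (x, t) l
    rw [← h1, ← map_add]
    simp
  rw [hψs, pairCLM_apply] at hfinal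
  simp only [hAs, mul_add, Finset.sum_add_distrib] at hfinal
  have hswap : ∑ i, ∑ j, F i j * ∑ l, fderiv ℝ (unA A i j) ((x, t), gradD w (x, t))
        (0, Pi.single l 1) * dirD (spaceDir l) (dirD (spaceDir k) w) (x, t)
      = ∑ l, (∑ i, ∑ j, F i j * fderiv ℝ (unA A i j) ((x, t), gradD w (x, t))
        (0, Pi.single l 1)) * dirD (spaceDir l) (dirD (spaceDir k) w) (x, t) := by
    simp only [Finset.mul_sum, Finset.sum_mul]
    symm
    rw [Finset.sum_comm]
    refine Finset.sum_congr rfl fun i _ => ?_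
    rw [Finset.sum_comm]
    simp only [mul_assoc]
  rw [hswap] at hfinal
  simp only [frozenOp, driftCoeff, sub_mul, Finset.sum_sub_distrib]
  change _ = fderiv ℝ (unPsi ψ) ((x, t), w (x, t), gradD w (x, t)) _ - _
  linarith

lemma abs_sum_sum_mul_le {n : ℕ} {F : Mat n} {S : ℝ} (hF : ∀ i j, |F i j| ≤ S)
    {c : Fin n → Fin n → ℝ} {M : ℝ} (hc : ∀ i j, |c i j| ≤ M) :
    |∑ i, ∑ j, F i j * c i j| ≤ n * (n * (S * M)) := by
  have h : ∀ i j, |F i j * c i j| ≤ S * M := fun i j => by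
    rw [abs_mul]
    exact mul_le_mul (hF i j) (hc i j) (abs_nonneg _) ((abs_nonneg _).trans (hF i j))
  calc |∑ i, ∑ j, F i j * c i j| ≤ ∑ i, ∑ j, |F i j * c i j| :=
        (Finset.abs_sum_le_sum_abs _ _).trans
          (Finset.sum_le_sum fun i _ => Finset.abs_sum_le_sum_abs _ _)
    _ ≤ ∑ _i : Fin n, ∑ _j : Fin n, S * M :=
        Finset.sum_le_sum fun i _ => Finset.sum_le_sum fun j _ => h i j
    _ = n * (n * (S * M)) := by simp

lemma abs_clm_le {E : Type*} [NormedAddCommGroup E] [NormedSpace ℝ E] {L : E →L[ℝ] ℝ} {M N : ℝ}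
    (hL : ‖L‖ ≤ M) {e : E} (he : ‖e‖ ≤ N) : |L e| ≤ M * N :=
  (L.le_opNorm e).trans (mul_le_mul hL he (norm_nonneg _) ((norm_nonneg _).trans hL))

/-- Uniform bounds for the first derivatives of `A` and `ψ` on the relevant compact sets. -/
lemma exists_bound_fderiv {n : ℕ} {Ω : Set (Fin n → ℝ)} (hΩ : Bornology.IsBounded Ω) (T : ℝ)
    {A : (Fin n → ℝ) → ℝ → (Fin n → ℝ) → Mat n} (hA : ASmooth A)
    {ψ : (Fin n → ℝ) → ℝ → ℝ → (Fin n → ℝ) → ℝ} (hψ : PsiSmooth ψ) (K : ℝ) :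
    ∃ M, 0 ≤ M ∧ ∀ q ∈ QTbar Ω T, ∀ p : Fin n → ℝ, ‖p‖ ≤ K →
      (∀ i j, ‖fderiv ℝ (unA A i j) (q, p)‖ ≤ M) ∧
        ∀ z : ℝ, |z| ≤ K → ‖fderiv ℝ (unPsi ψ) (q, z, p)‖ ≤ M := by
  have hcQ : IsCompact (QTbar Ω T) := hΩ.isCompact_closure.prod isCompact_Icc
  have hcp : IsCompact (Metric.closedBall (0 : Fin n → ℝ) K) := isCompact_closedBall _ _
  have hcz : IsCompact (Metric.closedBall (0 : ℝ) K) := isCompact_closedBall _ _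
  have hA' : ∀ i j, Continuous (fderiv ℝ (unA A i j)) := fun i j =>
    (hA.2 i j).continuous_fderiv (by simp)
  have hψ' : Continuous (fderiv ℝ (unPsi ψ)) := hψ.continuous_fderiv (by simp)
  choose a ha using fun i j =>
    (hcQ.prod hcp).exists_bound_of_continuousOn (hA' i j).continuousOn
  obtain ⟨b, hb⟩ := (hcQ.prod (hcz.prod hcp)).exists_bound_of_continuousOn hψ'.continuousOn
  refine ⟨(∑ i, ∑ j, |a i j|) + |b|, by positivity, fun q hq p hp => ⟨fun i j => ?_,
    fun z hz => ?_⟩⟩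
  · have h1 : |a i j| ≤ ∑ j, |a i j| :=
      Finset.single_le_sum (f := fun j => |a i j|) (fun _ _ => abs_nonneg _) (Finset.mem_univ j)
    have h2 : ∑ j, |a i j| ≤ ∑ i, ∑ j, |a i j| :=
      Finset.single_le_sum (f := fun i => ∑ j, |a i j|)
        (fun _ _ => Finset.sum_nonneg fun _ _ => abs_nonneg _) (Finset.mem_univ i)
    have h3 := ha i j (q, p) ⟨hq, by simpa using hp⟩
    linarith [le_abs_self (a i j), abs_nonneg b]
  · have h0 : 0 ≤ ∑ i, ∑ j, |a i j| := by positivity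
    have h3 := hb (q, z, p) ⟨hq, by simpa using hz, by simpa using hp⟩
    linarith [le_abs_self b]

lemma abs_driftCoeff_le {n : ℕ} {A : (Fin n → ℝ) → ℝ → (Fin n → ℝ) → Mat n}
    {ψ : (Fin n → ℝ) → ℝ → ℝ → (Fin n → ℝ) → ℝ} {F : Mat n} {S M : ℝ}
    (hF : ∀ i j, |F i j| ≤ S) {w : (Fin n → ℝ) × ℝ → ℝ} {q : (Fin n → ℝ) × ℝ}
    (hA : ∀ i j, ‖fderiv ℝ (unA A i j) (q, gradD w q)‖ ≤ M)
    (hψ : ‖fderiv ℝ (unPsi ψ) (q, w q, gradD w q)‖ ≤ M) (l : Fin n) :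
    |driftCoeff A ψ F w q l| ≤ n * (n * (S * M)) + M := by
  refine (abs_sub _ _).trans (add_le_add (abs_sum_sum_mul_le hF fun i j => ?_) ?_)
  · refine (abs_clm_le (hA i j) (N := 1) ?_).trans_eq (mul_one M)
    simpa [Prod.norm_def] using norm_single_one_le l
  · refine (abs_clm_le hψ (N := 1) ?_).trans_eq (mul_one M)
    simpa [Prod.norm_def] using norm_single_one_le l

lemma abs_frozenOp_le {n : ℕ} {F : Mat n} {b : Fin n → ℝ} {S B K : ℝ}
    (hF : ∀ i j, |F i j| ≤ S) (hb : ∀ l, |b l| ≤ B) {v : (Fin n → ℝ) × ℝ → ℝ}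
    {q : (Fin n → ℝ) × ℝ}
    (h2 : ∀ i j, |dirD (spaceDir i) (dirD (spaceDir j) v) q| ≤ K)
    (h1 : ∀ l, |dirD (spaceDir l) v q| ≤ K) (ht : |dirD (timeDir n) v q| ≤ K) :
    |frozenOp F b v q| ≤ n * (n * (S * K)) + n * (B * K) + K := by
  have h3 : |∑ l, b l * dirD (spaceDir l) v q| ≤ n * (B * K) := by
    refine (Finset.abs_sum_le_sum_abs _ _).trans ?_
    calc ∑ l, |b l * dirD (spaceDir l) v q| ≤ ∑ _l : Fin n, B * K :=
          Finset.sum_le_sum fun l _ => by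
            rw [abs_mul]
            exact mul_le_mul (hb l) (h1 l) (abs_nonneg _) ((abs_nonneg _).trans (hb l))
      _ = n * (B * K) := by simp
  exact (abs_sub _ _).trans
    (add_le_add ((abs_add_le _ _).trans (add_le_add (abs_sum_sum_mul_le hF h2) h3)) ht)

/-- inequality (eq3-1)/(4.2) of the paper, flat case:
`𝓛(∂_k(u − φ)) ≤ C (1 + Σᵢ fᵢ|λᵢ| + Σᵢ fᵢ)`, with `C` depending only on
`n, Ω, T, A, ψ` and `K`. -/
theorem statement13
    {n : ℕ} (hn : 2 ≤ n)
    (Ω : Set (Fin n → ℝ)) (hΩo : IsOpen Ω) (hΩb : Bornology.IsBounded Ω)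
    (hΩs : SmoothBoundary Ω)
    (T : ℝ) (hT : 0 < T)
    (A : (Fin n → ℝ) → ℝ → (Fin n → ℝ) → Mat n) (hA : ASmooth A)
    (ψ : (Fin n → ℝ) → ℝ → ℝ → (Fin n → ℝ) → ℝ) (hψ : PsiSmooth ψ) :
    ∀ K > 0, ∃ C > 0,
      ∀ (Γ : Set (Fin n → ℝ)) (f : (Fin n → ℝ) → ℝ) (u φ : (Fin n → ℝ) → ℝ → ℝ),
      GoodCone Γ → SmoothSymF Γ f → F1cond Γ f → F2cond Γ f →
      RegN 3 u → Admissible Γ A u (QTbar Ω T) → SolvesE f A ψ u (QT Ω T) →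
      RegN 3 φ →
      C1xBound u (QTbar Ω T) K → CkBound 3 φ (QTbar Ω T) K →
      ∀ k : Fin n, ∀ q ∈ QT Ω T,
        Lop f A ψ u (fun x t => sgrad (fun y => u y t - φ y t) x k) q.1 q.2
          ≤ C * (1
            + (∑ i, fLam f (eigenVec (Umat A u q.1 q.2)) i
                * |eigenVec (Umat A u q.1 q.2) i|)
            + ∑ i, fLam f (eigenVec (Umat A u q.1 q.2)) i) := by
  intro K hK
  obtain ⟨M, hM0, hM⟩ := exists_bound_fderiv hΩb T hA hψ K
  refine ⟨M * (1 + K) + n * (n * M) + n * (n * K) + n * ((n * (n * M) + M) * K) + K, by positivity,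
    ?_⟩
  intro Γ f u φ hΓ hf h1 h2 hu hadm hE hφ huK hφK k q hq
  obtain ⟨x, t⟩ := q
  have hqb : (x, t) ∈ QTbar Ω T := ⟨subset_closure hq.1, hq.2.1.le, hq.2.2⟩
  set w : (Fin n → ℝ) × ℝ → ℝ := fun q => u q.1 q.2 with hw
  set g : (Fin n → ℝ) × ℝ → ℝ := fun q => φ q.1 q.2 with hg
  have hw3 : ContDiff ℝ 3 w := hu
  have hg3 : ContDiff ℝ 3 g := hφ
  have hw2 : ContDiff ℝ 2 w := hw3.of_le (by norm_num)
  have hg2 : ContDiff ℝ 2 g := hg3.of_le (by norm_num)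
  have hw1 : Differentiable ℝ w := hw2.differentiable two_ne_zero
  have hg1 : Differentiable ℝ g := hg2.differentiable two_ne_zero
  have hDw : ContDiff ℝ 2 (dirD (spaceDir k) w) := ContDiff.dirD (m := 2) hw3 _
  have hDg : ContDiff ℝ 2 (dirD (spaceDir k) g) := ContDiff.dirD (m := 2) hg3 _
  have hv : (fun q : (Fin n → ℝ) × ℝ => sgrad (fun y => u y q.2 - φ y q.2) q.1 k)
      = fun q => dirD (spaceDir k) w q - dirD (spaceDir k) g q := by
    rw [← dirD_sub hw1 hg1]
    funext q
    exact sgrad_slice (u := fun y s => u y s - φ y s) (hw1.sub hg1) q.1 q.2 k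
  have hlam := hadm (x, t) hqb
  obtain ⟨hFd, hFb⟩ := hasFDerivAt_Ffunc_and_abs_Fmat_le hΓ hf h1 h2
    (Umat_isHermitian hA hw2 x t) hlam
  rw [Lop_eq_frozenOp (v := fun x t => sgrad (fun y => u y t - φ y t) x k) hA hψ hw1
    (by rw [hv]; exact hDw.sub hDg), hv, frozenOp_sub _ _ hDw hDg,
    frozenOp_dirD_eq hΩo hA hψ hu hE hq hFd k]
  have hgrad : sgrad (fun y => u y t) x = gradD w (x, t) :=
    funext fun l => sgrad_slice hw1 x t l
  have huq := huK (x, t) hqb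
  have hgK : ‖gradD w (x, t)‖ ≤ K := by
    rw [← hgrad]
    linarith [abs_nonneg (u x t)]
  have huK0 : |u x t| ≤ K := by
    linarith [norm_nonneg (sgrad (fun y => u y t) x)]
  obtain ⟨hAM, hψM⟩ := hM (x, t) hqb _ hgK
  replace hψM := hψM _ huK0
  have hDwK : |dirD (spaceDir k) w (x, t)| ≤ K := (norm_le_pi_norm (gradD w (x, t)) k).trans hgK
  have hψ1 : fderiv ℝ (unPsi ψ) ((x, t), u x t, gradD w (x, t))
      (spaceDir k, dirD (spaceDir k) w (x, t), 0) ≤ M * (1 + K) := by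
    refine (le_abs_self _).trans (abs_clm_le hψM ?_)
    have := norm_spaceDir_le k
    simp only [Prod.norm_mk, norm_zero, Real.norm_eq_abs, sup_le_iff]
    refine ⟨by linarith, by linarith, by linarith⟩
  have hA1 := abs_sum_sum_mul_le hFb
    (c := fun i j => fderiv ℝ (unA A i j) ((x, t), gradD w (x, t)) (spaceDir k, 0)) (M := M)
    fun i j => (abs_clm_le (hAM i j) (N := 1)
      (by simpa [Prod.norm_def] using norm_spaceDir_le k)).trans_eq (mul_one M)
  have hφ3 := hφK (x, t) hqb 3 le_rfl
  have hφ2 := hφK (x, t) hqb 2 (by norm_num)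
  have hfr := abs_frozenOp_le hFb
    (abs_driftCoeff_le (ψ := ψ) hFb (w := w) (q := (x, t)) hAM hψM)
    (v := dirD (spaceDir k) g) (K := K)
    (fun i j => (abs_dirD_dirD_dirD_le hg3 (norm_spaceDir_le i) (norm_spaceDir_le j)
      (norm_spaceDir_le k) _).trans hφ3)
    (fun l => (abs_dirD_dirD_le hg2 (norm_spaceDir_le l) (norm_spaceDir_le k) _).trans hφ2)
    ((abs_dirD_dirD_le hg2 (norm_timeDir_le n) (norm_spaceDir_le k) _).trans hφ2)
  change _ ≤ _ * (1 + (∑ i, fLam f (eigenVec (Umat A u x t)) i * |eigenVec (Umat A u x t) i|)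
    + ∑ i, fLam f (eigenVec (Umat A u x t)) i)
  have hS0 : 0 ≤ ∑ i, fLam f (eigenVec (Umat A u x t)) i :=
    Finset.sum_nonneg fun i _ => (h1 _ hlam i).le
  have hP0 : 0 ≤ ∑ i, fLam f (eigenVec (Umat A u x t)) i * |eigenVec (Umat A u x t) i| :=
    Finset.sum_nonneg fun i _ => mul_nonneg (h1 _ hlam i).le (abs_nonneg _)
  generalize (∑ i, fLam f (eigenVec (Umat A u x t)) i) = S at *
  generalize (∑ i, fLam f (eigenVec (Umat A u x t)) i * |eigenVec (Umat A u x t) i|) = P at *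
  refine (sub_le_sub (sub_le_sub hψ1 (neg_le_of_abs_le hA1)) (neg_le_of_abs_le hfr)).trans ?_
  have hC : 0 ≤ M * (1 + K) + n * (n * M) + n * (n * K) + n * ((n * (n * M) + M) * K) + K := by
    positivity
  calc _ ≤ (M * (1 + K) + n * (n * M) + n * (n * K) + n * ((n * (n * M) + M) * K) + K)
        * (1 + S) := by
        have e1 : 0 ≤ M * (1 + K) * S := by positivity
        have e2 : 0 ≤ (n : ℝ) * (n * M) := by positivity
        have e3 : 0 ≤ (n : ℝ) * (n * K) := by positivity
        have e4 : 0 ≤ (n : ℝ) * (M * K) * S := by positivity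
        have e5 : 0 ≤ (n : ℝ) * (n * (n * M) * K) := by positivity
        have e6 : 0 ≤ K * S := by positivity
        linarith
    _ ≤ _ := mul_le_mul_of_nonneg_left (by linarith) hC

end ParabolicHessian
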